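/- Let K ≥ 1/2 and β ∈ [2/5, 1/2] be real constants, define φ(s) = K + (1+s)^{−β} for s ≥ 0 and Φ(x) = ∫₀^x φ(s) ds for x ≥ 0. Then: (i) K ≤ φ(s) ≤ K + 1 for all s ≥ 0; (ii) φ is non-increasing on [0, ∞); (iii) the function s ↦ Φ(s²) is convex on ℝ; (iv) the derivative of s ↦ s·φ(s) satisfies |(s·φ(s))′| ≤ K + 1 for all s ≥ 0; (v) the function t ↦ φ(t²/2)·t² is convex on ℝ; (vi) for every real α ≥ 0, the function t ↦ Φ(t²/2) − (1/(2(1+α)))·φ(t²/2)·t² is convex on ℝ. -/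

import Mathlib

theorem aux_convex (f fd1 fd2 : ℝ → ℝ) (h1 : ∀ x, HasDerivAt f (fd1 x) x)
    (h2 : ∀ x, HasDerivAt fd1 (fd2 x) x) (h3 : ∀ x, 0 ≤ fd2 x) : ConvexOn ℝ Set.univ f := by
  have e1 : deriv f = fd1 := funext fun x => (h1 x).deriv
  have e2 : deriv fd1 = fd2 := funext fun x => (h2 x).deriv
  apply MonotoneOn.convexOn_of_deriv convex_univ
  · exact fun x _ => (h1 x).continuousAt.continuousWithinAt
  · exact fun x _ => (h1 x).differentiableAt.differentiableWithinAt
  · rw [e1]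
    refine (monotone_of_deriv_nonneg (fun x => (h2 x).differentiableAt) ?_).monotoneOn _
    intro x
    rw [e2]
    exact h3 x

theorem aux_phi (β s : ℝ) (hs : 0 ≤ s) :
    HasDerivAt (fun s : ℝ => (1 + s) ^ (-β)) (-β * ((1 + s) ^ (-β) / (1 + s))) s := by
  have h : HasDerivAt (fun s : ℝ => 1 + s) 1 s := (hasDerivAt_id s).const_add 1
  have := h.rpow_const (p := -β) (Or.inl (by positivity))
  convert this using 1
  rw [Real.rpow_sub_one (by positivity)]
  ring

theorem aux_W (K β k t : ℝ) (hk : 0 ≤ k) :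
    HasDerivAt (fun t : ℝ => K + (1 + k * t ^ 2) ^ (-β))
      (-β * ((1 + k * t ^ 2) ^ (-β) / (1 + k * t ^ 2)) * (k * (2 * t))) t := by
  have h : HasDerivAt (fun t : ℝ => k * t ^ 2) (k * (2 * t)) t := by
    simpa using (hasDerivAt_pow 2 t).const_mul k
  exact ((aux_phi β (k * t ^ 2) (by positivity)).comp t h).const_add K

theorem aux_Q (β k t : ℝ) (hk : 0 ≤ k) :
    HasDerivAt (fun t : ℝ => (1 + k * t ^ 2) ^ (-β) / (1 + k * t ^ 2))
      ((-β - 1) * ((1 + k * t ^ 2) ^ (-β) / (1 + k * t ^ 2) ^ 2) * (k * (2 * t))) t := by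
  have h : HasDerivAt (fun t : ℝ => 1 + k * t ^ 2) (k * (2 * t)) t := by
    simpa using ((hasDerivAt_pow 2 t).const_mul k).const_add 1
  have hp : 0 < 1 + k * t ^ 2 := by positivity
  have h0 : HasDerivAt (fun t : ℝ => (1 + k * t ^ 2) ^ (-β))
      (-β * ((1 + k * t ^ 2) ^ (-β) / (1 + k * t ^ 2)) * (k * (2 * t))) t := by
    have := aux_W 0 β k t hk
    simp only [zero_add] at this
    exact this
  refine (h0.div h hp.ne').congr_deriv ?_
  field_simp

theorem aux_Phi (K β : ℝ) (φ : ℝ → ℝ) (hφ : ∀ s : ℝ, φ s = K + (1 + s) ^ (-β))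
    (Φ : ℝ → ℝ) (hΦ : ∀ x : ℝ, Φ x = ∫ s in (0:ℝ)..x, φ s) (x : ℝ) (hx : 0 ≤ x) :
    HasDerivAt Φ (φ x) x := by
  have e : Φ = fun x => ∫ s in (0:ℝ)..x, φ s := funext hΦ
  have e2 : φ = fun s => K + (1 + s) ^ (-β) := funext hφ
  have hc : ∀ s, 0 ≤ s → ContinuousAt φ s := by
    intro s hs
    rw [e2]
    exact ((aux_phi β s hs).const_add K).continuousAt
  have hm : Measurable φ := by
    rw [e2]
    fun_prop
  rw [e]
  apply intervalIntegral.integral_hasDerivAt_right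
  · apply ContinuousOn.intervalIntegrable
    intro s hs
    rw [Set.uIcc_of_le hx] at hs
    exact (hc s hs.1).continuousWithinAt
  · exact hm.stronglyMeasurable.stronglyMeasurableAtFilter
  · exact hc x hx


theorem stmt15 (K β : ℝ) (hK : 1/2 ≤ K) (hβ : β ∈ Set.Icc (2/5 : ℝ) (1/2))
    (φ : ℝ → ℝ) (hφ : ∀ s : ℝ, φ s = K + (1 + s) ^ (-β))
    (Φ : ℝ → ℝ) (hΦ : ∀ x : ℝ, Φ x = ∫ s in (0:ℝ)..x, φ s) :
    (∀ s : ℝ, 0 ≤ s → K ≤ φ s ∧ φ s ≤ K + 1) ∧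
    (∀ s t : ℝ, 0 ≤ s → s ≤ t → φ t ≤ φ s) ∧
    ConvexOn ℝ Set.univ (fun s : ℝ => Φ (s ^ 2)) ∧
    (∀ s : ℝ, 0 ≤ s → |deriv (fun s : ℝ => s * φ s) s| ≤ K + 1) ∧
    ConvexOn ℝ Set.univ (fun t : ℝ => φ (t ^ 2 / 2) * t ^ 2) ∧
    (∀ α : ℝ, 0 ≤ α → ConvexOn ℝ Set.univ
      (fun t : ℝ => Φ (t ^ 2 / 2) - 1 / (2 * (1 + α)) * (φ (t ^ 2 / 2) * t ^ 2))) := by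
  obtain ⟨hb1, hb2⟩ := hβ
  have hW1 : ∀ s : ℝ, 0 ≤ s → (1 + s) ^ (-β) ≤ 1 := fun s hs =>
    Real.rpow_le_one_of_one_le_of_nonpos (by linarith) (by linarith)
  have hW0 : ∀ s : ℝ, 0 ≤ s → 0 < (1 + s) ^ (-β) := fun s hs =>
    Real.rpow_pos_of_pos (by linarith) _
  have hsq : ∀ (k t : ℝ), HasDerivAt (fun t : ℝ => k * t ^ 2) (k * (2 * t)) t := by
    intro k t
    simpa using (hasDerivAt_pow 2 t).const_mul k
  have hPc : ∀ (k t : ℝ), 0 ≤ k → HasDerivAt (fun t : ℝ => Φ (k * t ^ 2))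
      ((K + (1 + k * t ^ 2) ^ (-β)) * (k * (2 * t))) t := by
    intro k t hk
    rw [← hφ]
    exact (aux_Phi K β φ hφ Φ hΦ (k * t ^ 2) (by positivity)).comp t (hsq k t)
  have hPc2 : ∀ (k t : ℝ), 0 ≤ k → HasDerivAt
      (fun t : ℝ => (K + (1 + k * t ^ 2) ^ (-β)) * (k * (2 * t)))
      ((-β * ((1 + k * t ^ 2) ^ (-β) / (1 + k * t ^ 2)) * (k * (2 * t))) * (k * (2 * t))
        + (K + (1 + k * t ^ 2) ^ (-β)) * (k * (2 * 1))) t := by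
    intro k t hk
    exact (aux_W K β k t hk).mul (((hasDerivAt_id t).const_mul 2).const_mul k)
  have hF1 : ∀ t : ℝ, HasDerivAt (fun t : ℝ => (K + (1 + 1/2 * t ^ 2) ^ (-β)) * t ^ 2)
      (-β * ((1 + 1/2 * t ^ 2) ^ (-β) / (1 + 1/2 * t ^ 2)) * t ^ 3
        + (K + (1 + 1/2 * t ^ 2) ^ (-β)) * (2 * t)) t := by
    intro t
    have h : HasDerivAt (fun t : ℝ => t ^ 2) (2 * t) t := by simpa using hasDerivAt_pow 2 t
    refine ((aux_W K β (1/2) t (by norm_num)).mul h).congr_deriv ?_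
    ring
  have hF2 : ∀ t : ℝ, HasDerivAt (fun t : ℝ =>
      -β * ((1 + 1/2 * t ^ 2) ^ (-β) / (1 + 1/2 * t ^ 2)) * t ^ 3
        + (K + (1 + 1/2 * t ^ 2) ^ (-β)) * (2 * t))
      (2 * K + (1 + 1/2 * t ^ 2) ^ (-β) / (1 + 1/2 * t ^ 2) ^ 2 *
        (2 + (4 - 10 * β) * (1/2 * t ^ 2) + 2 * (1 - β) * (1 - 2 * β) * (1/2 * t ^ 2) ^ 2)) t := by
    intro t
    have h3 : HasDerivAt (fun t : ℝ => t ^ 3) (3 * t ^ 2) t := by simpa using hasDerivAt_pow 3 t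
    have hp : 0 < 1 + 1/2 * t ^ 2 := by positivity
    refine ((((aux_Q β (1/2) t (by norm_num)).const_mul (-β)).mul h3).add
      ((aux_W K β (1/2) t (by norm_num)).mul ((hasDerivAt_id t).const_mul 2))).congr_deriv ?_
    generalize (1 + 1/2 * t ^ 2) ^ (-β) = W
    try simp only [id]
    field_simp
    ring
  have hhalf : ∀ t : ℝ, t ^ 2 / 2 = 1/2 * t ^ 2 := fun t => by ring
  refine ⟨?_, ?_, ?_, ?_, ?_, ?_⟩
  · intro s hs
    rw [hφ]
    constructor <;> linarith [hW1 s hs, hW0 s hs]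
  · intro s t hs hst
    rw [hφ, hφ]
    have := Real.rpow_le_rpow_of_nonpos (x := 1 + s) (y := 1 + t) (z := -β)
      (by linarith) (by linarith) (by linarith)
    linarith
  · refine aux_convex _ (fun t : ℝ => (K + (1 + 1 * t ^ 2) ^ (-β)) * (1 * (2 * t))) _ ?_
      (fun t => hPc2 1 t (by norm_num)) ?_
    · intro t
      simpa using hPc 1 t (by norm_num)
    · intro t
      have hx : 0 ≤ 1 * t ^ 2 := by positivity
      have h0 := hW0 _ hx
      have hp : 0 < 1 + 1 * t ^ 2 := by positivity
      have : 0 ≤ 2 * K + 2 * ((1 + 1 * t ^ 2) ^ (-β) / (1 + 1 * t ^ 2)) *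
          (1 + (1 - 2 * β) * t ^ 2) := by
        have : 0 ≤ 1 - 2 * β := by linarith
        positivity
      convert this using 1
      revert h0
      generalize (1 + 1 * t ^ 2) ^ (-β) = W
      intro h0
      field_simp
      ring
  · intro s hs
    have e : (fun s : ℝ => s * φ s) = fun s => s * (K + (1 + s) ^ (-β)) := by
      funext s
      rw [hφ]
    rw [e]
    have h := (hasDerivAt_id s).mul ((aux_phi β s hs).const_add K)
    have hder : deriv (fun s : ℝ => s * (K + (1 + s) ^ (-β))) s = _ := h.deriv
    rw [hder]
    have h0 := hW0 s hs
    have h1 := hW1 s hs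
    revert h0 h1
    simp only [id]
    generalize (1 + s) ^ (-β) = W
    intro h0 h1
    have hq : W / (1 + s) * s ≤ W := by
      rw [div_mul_eq_mul_div, div_le_iff₀ (by linarith)]
      nlinarith
    have hq0 : 0 ≤ W / (1 + s) * s := by positivity
    rw [abs_le]
    constructor <;> nlinarith
  · simp only [hhalf, hφ]
    refine aux_convex _ _ _ hF1 hF2 ?_
    intro t
    have hx : 0 ≤ 1/2 * t ^ 2 := by positivity
    have h0 := hW0 _ hx
    have h1 := hW1 _ hx
    revert h0 h1
    generalize (1 + 1/2 * t ^ 2) ^ (-β) = W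
    revert hx
    generalize 1/2 * t ^ 2 = x
    intro hx h0 h1
    have hA : W / (1 + x) ^ 2 * (1 + x) ^ 2 = W := by field_simp
    have hA0 : 0 ≤ W / (1 + x) ^ 2 := by positivity
    revert hA hA0
    generalize W / (1 + x) ^ 2 = A
    intro hA hA0
    have hB : 0 ≤ 2 * (1 - β) * (1 - 2 * β) * x ^ 2 := by
      have : 0 ≤ 1 - 2 * β := by linarith
      have : 0 ≤ 1 - β := by linarith
      positivity
    have hC : 0 ≤ A * ((1 + x) ^ 2 + (2 + (4 - 10 * β) * x
        + 2 * (1 - β) * (1 - 2 * β) * x ^ 2)) := by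
      apply mul_nonneg hA0
      nlinarith [sq_nonneg x]
    nlinarith
  · intro α hα
    obtain ⟨θ, hθ⟩ : ∃ θ, θ = 1 / (1 + α) := ⟨_, rfl⟩
    have hθ0 : 0 ≤ θ := by rw [hθ]; positivity
    have hθ1 : θ ≤ 1 := by
      rw [hθ, div_le_one (by linarith)]
      linarith
    have hc : 1 / (2 * (1 + α)) = θ / 2 := by
      rw [hθ]
      field_simp
    rw [hc]
    simp only [hhalf, hφ]
    refine aux_convex _ _ _ (fun t => (hPc (1/2) t (by norm_num)).sub ((hF1 t).const_mul (θ / 2)))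
      (fun t => (hPc2 (1/2) t (by norm_num)).sub ((hF2 t).const_mul (θ / 2))) ?_
    intro t
    have hx : 0 ≤ 1/2 * t ^ 2 := by positivity
    have h0 := hW0 _ hx
    have hp : 0 < 1 + 1/2 * t ^ 2 := by positivity
    have hb : 0 ≤ 1 - 2 * β := by linarith
    have hb0 : 0 ≤ β := by linarith
    have ht : 0 ≤ 1 - θ := by linarith
    have : 0 ≤ (1 - θ) * (K + ((1 + 1/2 * t ^ 2) ^ (-β) / (1 + 1/2 * t ^ 2)) *
          (1 + (1 - 2 * β) * (1/2 * t ^ 2))) + θ * ((1 + 1/2 * t ^ 2) ^ (-β) /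
          (1 + 1/2 * t ^ 2) ^ 2 * (3 * β * (1/2 * t ^ 2)
            + β * (1 - 2 * β) * (1/2 * t ^ 2) ^ 2)) := by
      positivity
    convert this using 1
    generalize (1 + 1/2 * t ^ 2) ^ (-β) = W
    try simp only [id]
    field_simp
    ring
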